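/- For each 1 < p < ∞ there exists a bounded linear operator T : C([0,1], ℓ₂) → ℓ₂ that is not p-summing, but such that T# maps C[0,1] into Π_p(ℓ₂, ℓ₂) and T# : C[0,1] → Π_p(ℓ₂, ℓ₂) is p-summing. -/

import Mathlib

set_option maxHeartbeats 1000000
set_option synthInstance.maxHeartbeats 400000

noncomputable section

open scoped BigOperators NNReal ENNReal
open NormedSpace

/-- The scalar field. -/
notation "𝕂" => ℝ
section Summing

variable {E F : Type} [NormedAddCommGroup E] [NormedSpace 𝕂 E]
  [NormedAddCommGroup F] [NormedSpace 𝕂 F]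

/-- The weak ℓ_q norm of a finite family of vectors:
`sup { (Σ_i ‖e*(e_i)‖^q)^(1/q) : e* ∈ E*, ‖e*‖ ≤ 1 }`. -/
def weakNorm (q : ℝ) {n : ℕ} (e : Fin n → E) : ℝ :=
  ⨆ f : {f : StrongDual 𝕂 E // ‖f‖ ≤ 1}, (∑ i, ‖(f : StrongDual 𝕂 E) (e i)‖ ^ q) ^ (1 / q)

/-- `T` satisfies the (p,q)-summing inequality with constant `C`:
`(Σ_i ‖T e_i‖^p)^(1/p) ≤ C · sup { (Σ_i ‖e*(e_i)‖^q)^(1/q) : ‖e*‖ ≤ 1 }`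
for all finite families `e_1, …, e_n`. -/
def SummingWithC (p q C : ℝ) (T : E →L[𝕂] F) : Prop :=
  ∀ (n : ℕ) (e : Fin n → E),
    (∑ i, ‖T (e i)‖ ^ p) ^ (1 / p) ≤ C * weakNorm q e

/-- `T` is (p,q)-summing. -/
def IsPQSumming (p q : ℝ) (T : E →L[𝕂] F) : Prop :=
  ∃ C, 0 ≤ C ∧ SummingWithC p q C T

/-- `T` is p-summing. -/
def IsPSumming (p : ℝ) (T : E →L[𝕂] F) : Prop := IsPQSumming p p T

/-- The p-summing norm `π_p(T)`: the least admissible constant. -/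
def pNorm (p : ℝ) (T : E →L[𝕂] F) : ℝ :=
  sInf {C | 0 ≤ C ∧ SummingWithC p p C T}

end Summing

/-- For `f : C(Ω, 𝕂)` and a vector `y`, the function `f ⊗ y : t ↦ f(t) • y`, under the
identification `C(Ω) ⊗̂_ε H = C(Ω, H)`. -/
def cmSmul {Ω : Type} [TopologicalSpace Ω] {H : Type} [NormedAddCommGroup H]
    [NormedSpace 𝕂 H] (f : C(Ω, 𝕂)) (y : H) : C(Ω, H) :=
  ⟨fun t => f t • y, (map_continuous f).smul continuous_const⟩

section Helpers
open MeasureTheory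

/-- The unit interval. -/
abbrev UI : Type := ↥(Set.Icc (0 : ℝ) 1)
/-- Real sequence space `ℓ₂`. -/
abbrev HH : Type := ↥(lp (fun _ : ℕ => ℝ) 2)

/-- Lebesgue measure on the unit interval. -/
def lam : Measure UI := (volume : Measure unitInterval)

instance lam_prob : IsProbabilityMeasure lam :=
  inferInstanceAs (IsProbabilityMeasure (volume : Measure unitInterval))

lemma integrable_lam {X : Type} [NormedAddCommGroup X] {f : UI → X}
    (hf : Continuous f) : Integrable f lam :=
  hf.integrable_of_hasCompactSupport (HasCompactSupport.of_compactSpace f)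

/-- Cosine functions. -/
def cc (j : ℕ) : C(UI, ℝ) := ⟨fun t => Real.cos (Real.pi * (j + 1) * t), by fun_prop⟩

lemma cc_abs (j : ℕ) (t : UI) : |cc j t| ≤ 1 := Real.abs_cos_le_one _

lemma lam_int (f : ℝ → ℝ) : ∫ t : UI, f t ∂lam = ∫ t in (0:ℝ)..1, f t := by
  rw [intervalIntegral.integral_of_le zero_le_one, ← integral_Icc_eq_integral_Ioc]
  exact integral_subtype (measurableSet_Icc) f

lemma int_cos (m : ℤ) (hm : m ≠ 0) : ∫ t in (0:ℝ)..1, Real.cos (Real.pi * m * t) = 0 := by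
  have h : Real.pi * (m:ℝ) ≠ 0 := mul_ne_zero Real.pi_ne_zero (by exact_mod_cast hm)
  rw [intervalIntegral.integral_comp_mul_left (fun x => Real.cos x) h, integral_cos]
  have : Real.sin (Real.pi * m) = 0 := by rw [mul_comm]; exact Real.sin_int_mul_pi m
  simp [this]

lemma cc_int (j k : ℕ) : ∫ t, cc j t * cc k t ∂lam = if j = k then 1/2 else 0 := by
  have h1 := lam_int (fun t => Real.cos (Real.pi * (j + 1) * t) * Real.cos (Real.pi * (k + 1) * t))
  change ∫ t : UI, Real.cos (Real.pi * (j + 1) * t) * Real.cos (Real.pi * (k + 1) * t) ∂lam = _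
  rw [h1]
  have h2 : ∀ t : ℝ, Real.cos (Real.pi * (j + 1) * t) * Real.cos (Real.pi * (k + 1) * t)
      = 1/2 * (Real.cos (Real.pi * ((j - k : ℤ) : ℝ) * t)
        + Real.cos (Real.pi * ((j + k + 2 : ℤ) : ℝ) * t)) := by
    intro t
    have a : Real.pi * ((j - k : ℤ) : ℝ) * t
      = Real.pi * (j + 1) * t - Real.pi * (k + 1) * t := by push_cast; ring
    have b : Real.pi * ((j + k + 2 : ℤ) : ℝ) * t
      = Real.pi * (j + 1) * t + Real.pi * (k + 1) * t := by push_cast; ring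
    rw [a, b, Real.cos_sub, Real.cos_add]; ring
  simp_rw [h2]
  rw [intervalIntegral.integral_const_mul, intervalIntegral.integral_add
    (Continuous.intervalIntegrable (by fun_prop) _ _)
    (Continuous.intervalIntegrable (by fun_prop) _ _), int_cos (j + k + 2) (by omega)]
  split_ifs with h
  · subst h; simp
  · rw [int_cos _ (by omega)]; simp

/-- The vector valued test functions. -/
def hh (n : ℕ → ℕ) (i : ℕ) : C(UI, HH) :=
  ⟨fun t => (Real.sqrt (n i))⁻¹ • ∑ j ∈ Finset.range (n i),
    cc j t • (lp.single 2 (Nat.pair i j) (1:ℝ) : HH), by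
      have : ∀ j, Continuous (cc j) := fun j => (cc j).continuous
      fun_prop⟩

lemma inner_hh (n : ℕ → ℕ) (i : ℕ) (t : UI) (y : HH) :
    inner ℝ (hh n i t) y
      = (Real.sqrt (n i))⁻¹ * ∑ j ∈ Finset.range (n i), cc j t * y (Nat.pair i j) := by
  change inner ℝ ((Real.sqrt (n i))⁻¹ • ∑ j ∈ Finset.range (n i),
    cc j t • (lp.single 2 (Nat.pair i j) (1:ℝ) : HH)) y = _
  rw [real_inner_smul_left, sum_inner]
  congr 1
  refine Finset.sum_congr rfl fun j _ => ?_
  rw [real_inner_smul_left, lp.inner_single_left]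
  simp

lemma sum_sq_le (y : HH) (s : Finset ℕ) : ∑ m ∈ s, y m ^ 2 ≤ ‖y‖ ^ 2 := by
  have := lp.sum_rpow_le_norm_rpow (p := 2) (by simp) y s
  simpa using this

lemma inner_hh_sq (n : ℕ → ℕ) (hn : ∀ i, 0 < n i) (i : ℕ) (t : UI) (y : HH) :
    inner ℝ (hh n i t) y ^ 2 ≤ ∑ j ∈ Finset.range (n i), y (Nat.pair i j) ^ 2 := by
  rw [inner_hh, mul_pow, inv_pow, Real.sq_sqrt (by positivity)]
  have h0 : (0:ℝ) < n i := by exact_mod_cast hn i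
  rw [inv_mul_le_iff₀ h0]
  refine (Finset.sum_mul_sq_le_sq_mul_sq _ _ _).trans ?_
  refine mul_le_mul_of_nonneg_right ?_ (Finset.sum_nonneg fun _ _ => sq_nonneg _)
  calc ∑ j ∈ Finset.range (n i), cc j t ^ 2 ≤ ∑ j ∈ Finset.range (n i), (1:ℝ) :=
        Finset.sum_le_sum fun j _ => (sq_le_one_iff_abs_le_one _).2 (cc_abs j t)
    _ = n i := by simp

lemma bessel (n : ℕ → ℕ) (hn : ∀ i, 0 < n i) (s : Finset ℕ) (t : UI) (y : HH) :
    ∑ i ∈ s, inner ℝ (hh n i t) y ^ 2 ≤ ‖y‖ ^ 2 := by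
  refine (Finset.sum_le_sum fun i _ => inner_hh_sq n hn i t y).trans ?_
  rw [Finset.sum_sigma']
  have hinj : Set.InjOn (fun x : (Σ _ : ℕ, ℕ) => Nat.pair x.1 x.2)
      (s.sigma fun i => Finset.range (n i) : Finset _) := by
    rintro ⟨a, b⟩ _ ⟨c, d⟩ _ h
    have := Nat.pair_eq_pair.1 h
    obtain ⟨rfl, rfl⟩ := this
    rfl
  rw [← Finset.sum_image (f := fun m => y m ^ 2) hinj]
  exact sum_sq_le y _

lemma abs_inner_hh_le (n : ℕ → ℕ) (hn : ∀ i, 0 < n i) (i : ℕ) (t : UI) (y : HH) :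
    |inner ℝ (hh n i t) y| ≤ ‖y‖ := by
  have := bessel n hn {i} t y
  rw [Finset.sum_singleton] at this
  exact abs_le_of_sq_le_sq this (norm_nonneg y)

lemma int_sq (n : ℕ → ℕ) (hn : ∀ i, 0 < n i) (i : ℕ) (y : HH) :
    ∫ t, inner ℝ (hh n i t) y ^ 2 ∂lam ≤ ‖y‖ ^ 2 / n i := by
  have hc : ∀ j, Continuous (cc j) := fun j => (cc j).continuous
  have h0 : (0:ℝ) < n i := by exact_mod_cast hn i
  have e : ∀ t, inner ℝ (hh n i t) y ^ 2 = (n i : ℝ)⁻¹ *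
      ∑ j ∈ Finset.range (n i), ∑ k ∈ Finset.range (n i),
        (y (Nat.pair i j) * y (Nat.pair i k)) * (cc j t * cc k t) := by
    intro t
    rw [inner_hh, mul_pow, inv_pow, Real.sq_sqrt (by positivity), sq, Finset.sum_mul_sum]
    congr 1
    refine Finset.sum_congr rfl fun j _ => Finset.sum_congr rfl fun k _ => by ring
  simp_rw [e]
  rw [integral_const_mul, integral_finsetSum _ (fun j _ => integrable_lam (by fun_prop))]
  have e2 : ∀ j ∈ Finset.range (n i), ∫ t, ∑ k ∈ Finset.range (n i),
        (y (Nat.pair i j) * y (Nat.pair i k)) * (cc j t * cc k t) ∂lam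
        = 1/2 * y (Nat.pair i j) ^ 2 := by
    intro j hj
    rw [integral_finsetSum _ (fun j _ => integrable_lam (by fun_prop))]
    simp_rw [integral_const_mul, cc_int]
    simp only [mul_ite, mul_zero, Finset.sum_ite_eq, hj, if_true]
    ring
  rw [Finset.sum_congr rfl e2, ← Finset.mul_sum, div_eq_inv_mul (‖y‖ ^ 2)]
  refine mul_le_mul_of_nonneg_left ?_ (by positivity)
  have hinj : Set.InjOn (fun x : ℕ => Nat.pair i x) (Finset.range (n i)) := by
    intro a _ b _ h
    exact (Nat.pair_eq_pair.1 h).2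
  have h3 := sum_sq_le y ((Finset.range (n i)).image (fun x => Nat.pair i x))
  rw [Finset.sum_image hinj] at h3
  nlinarith [sq_nonneg ‖y‖]

lemma diag_int (n : ℕ → ℕ) (hn : ∀ i, 0 < n i) (i : ℕ) :
    ∫ t, inner ℝ (hh n i t) (hh n i t) ∂lam = 1/2 := by
  have hc : ∀ j, Continuous (cc j) := fun j => (cc j).continuous
  have h0 : (0:ℝ) < n i := by exact_mod_cast hn i
  have e0 : ∀ t, ∀ j ∈ Finset.range (n i),
      hh n i t (Nat.pair i j) = (Real.sqrt (n i))⁻¹ * cc j t := by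
    intro t j hj
    have : inner ℝ (hh n i t) (lp.single 2 (Nat.pair i j) (1:ℝ) : HH)
       = hh n i t (Nat.pair i j) := by
      rw [lp.inner_single_right]; simp
    rw [← this, inner_hh]
    congr 1
    rw [Finset.sum_eq_single j]
    · simp
    · intro k _ hk
      rw [lp.single_apply_ne, mul_zero]
      intro h
      exact hk (Nat.pair_eq_pair.1 h).2
    · intro h; exact absurd hj h
  have e : ∀ t, inner ℝ (hh n i t) (hh n i t) = (n i : ℝ)⁻¹ *
      ∑ j ∈ Finset.range (n i), (cc j t * cc j t) := by
    intro t
    rw [inner_hh]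
    rw [Finset.sum_congr rfl (fun j hj => by rw [e0 t j hj]), Finset.mul_sum, Finset.mul_sum]
    refine Finset.sum_congr rfl fun j _ => ?_
    have : (n i : ℝ)⁻¹ = (Real.sqrt (n i))⁻¹ * (Real.sqrt (n i))⁻¹ := by
      rw [← mul_inv, Real.mul_self_sqrt h0.le]
    rw [this]; ring
  simp_rw [e]
  rw [integral_const_mul, integral_finsetSum _ (fun j _ => integrable_lam (by fun_prop))]
  simp_rw [cc_int]
  simp
  field_simp

lemma cont_inner (n : ℕ → ℕ) (i : ℕ) (φ : C(UI, HH)) :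
    Continuous fun t => inner ℝ (hh n i t) (φ t) :=
  (hh n i).continuous.inner φ.continuous

lemma sq_int_le {f : UI → ℝ} (hf : Continuous f) :
    (∫ t, f t ∂lam) ^ 2 ≤ ∫ t, f t ^ 2 ∂lam := by
  set m := ∫ t, f t ∂lam with hm
  have h : 0 ≤ ∫ t, (f t - m) ^ 2 ∂lam := integral_nonneg fun t => sq_nonneg _
  have e : ∀ t, (f t - m) ^ 2 = f t ^ 2 - (2 * m) * f t + m ^ 2 := fun t => by ring
  simp_rw [e] at h
  rw [integral_add (integrable_lam (by fun_prop)) (integrable_lam (by fun_prop)),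
    integral_sub (integrable_lam (by fun_prop)) (integrable_lam (by fun_prop)),
    integral_const_mul, ← hm] at h
  simp at h
  nlinarith

lemma sum_coord_le (n : ℕ → ℕ) (hn : ∀ i, 0 < n i) (φ : C(UI, HH)) (s : Finset ℕ) :
    ∑ i ∈ s, ‖∫ t, inner ℝ (hh n i t) (φ t) ∂lam‖ ^ (2 : ℝ≥0∞).toReal
      ≤ ‖φ‖ ^ (2 : ℝ≥0∞).toReal := by
  have hc := fun i => cont_inner n i φ
  simp only [ENNReal.toReal_ofNat, Real.rpow_ofNat, Real.norm_eq_abs, sq_abs]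
  calc ∑ i ∈ s, (∫ t, inner ℝ (hh n i t) (φ t) ∂lam) ^ 2
      ≤ ∑ i ∈ s, ∫ t, inner ℝ (hh n i t) (φ t) ^ 2 ∂lam :=
        Finset.sum_le_sum fun i _ => sq_int_le (hc i)
    _ = ∫ t, ∑ i ∈ s, inner ℝ (hh n i t) (φ t) ^ 2 ∂lam := by
        rw [integral_finsetSum _ (fun i _ => integrable_lam (by fun_prop))]
    _ ≤ ∫ t, ‖φ‖ ^ 2 ∂lam := by
        refine integral_mono (integrable_lam (by fun_prop)) (integrable_lam (by fun_prop)) ?_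
        intro t
        exact (bessel n hn s t (φ t)).trans
          (pow_le_pow_left₀ (norm_nonneg _) (φ.norm_coe_le_norm t) 2)
    _ = ‖φ‖ ^ 2 := by simp

/-- The operator. -/
def TT (n : ℕ → ℕ) (hn : ∀ i, 0 < n i) : C(UI, HH) →L[ℝ] HH :=
  LinearMap.mkContinuous
    { toFun := fun φ => ⟨fun i => ∫ t, inner ℝ (hh n i t) (φ t) ∂lam,
        memℓp_gen' (sum_coord_le n hn φ)⟩
      map_add' := by
        intro φ ψ
        ext i
        change ∫ t, inner ℝ (hh n i t) (φ t + ψ t) ∂lam = _ + _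
        simp_rw [inner_add_right]
        exact integral_add (integrable_lam (cont_inner n i φ)) (integrable_lam (cont_inner n i ψ))
      map_smul' := by
        intro r φ
        ext i
        change ∫ t, inner ℝ (hh n i t) (r • φ t) ∂lam = r * _
        simp_rw [real_inner_smul_right]
        exact integral_const_mul _ _ } 1 (by
    intro φ
    rw [one_mul]
    exact lp.norm_le_of_forall_sum_le (by simp) (norm_nonneg _) (sum_coord_le n hn φ))

lemma TT_apply (n : ℕ → ℕ) (hn : ∀ i, 0 < n i) (φ : C(UI, HH)) (i : ℕ) :
    TT n hn φ i = ∫ t, inner ℝ (hh n i t) (φ t) ∂lam := rfl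

section weak
variable {E : Type} [NormedAddCommGroup E] [NormedSpace ℝ E]

lemma weak_bdd {p : ℝ} (hp : 1 < p) {m : ℕ} (e : Fin m → E) :
    BddAbove (Set.range fun f : {f : StrongDual ℝ E // ‖f‖ ≤ 1} =>
      (∑ i, ‖(f : StrongDual ℝ E) (e i)‖ ^ p) ^ (1 / p)) := by
  refine ⟨(∑ i, ‖e i‖ ^ p) ^ (1 / p), ?_⟩
  rintro _ ⟨f, rfl⟩
  have hp0 : 0 < p := by linarith
  refine Real.rpow_le_rpow (Finset.sum_nonneg fun _ _ => by positivity)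
    (Finset.sum_le_sum fun i _ => Real.rpow_le_rpow (norm_nonneg _) ?_ hp0.le) (by positivity)
  have := (f : StrongDual ℝ E).le_of_opNorm_le f.2 (e i)
  linarith

lemma weak_ge {p : ℝ} (hp : 1 < p) {m : ℕ} (e : Fin m → E) (g : StrongDual ℝ E) (hg : ‖g‖ ≤ 1) :
    (∑ i, ‖g (e i)‖ ^ p) ^ (1 / p) ≤ weakNorm p e :=
  le_ciSup (weak_bdd hp e) ⟨g, hg⟩

lemma weak_nonneg {p : ℝ} {m : ℕ} (e : Fin m → E) : 0 ≤ weakNorm p e :=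
  Real.iSup_nonneg fun f => Real.rpow_nonneg (Finset.sum_nonneg fun _ _ => by positivity) _

lemma weak_le {p K : ℝ} {m : ℕ} (e : Fin m → E)
    (h : ∀ g : StrongDual ℝ E, ‖g‖ ≤ 1 → (∑ i, ‖g (e i)‖ ^ p) ^ (1 / p) ≤ K) :
    weakNorm p e ≤ K := by
  have : Nonempty {f : StrongDual ℝ E // ‖f‖ ≤ 1} := ⟨⟨0, by simp⟩⟩
  exact ciSup_le fun f => h f.1 f.2

lemma weak_ge' {p : ℝ} (hp : 1 < p) {m : ℕ} (e : Fin m → E) (g : StrongDual ℝ E) {K : ℝ}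
    (hK : 0 ≤ K) (hg : ‖g‖ ≤ K) :
    (∑ i, ‖g (e i)‖ ^ p) ^ (1 / p) ≤ K * weakNorm p e := by
  have hp0 : 0 < p := by linarith
  rcases hK.eq_or_lt with h0 | h0
  · have : g = 0 := norm_le_zero_iff.1 (h0 ▸ hg)
    subst this
    simp [Real.zero_rpow hp0.ne', ← h0, Real.zero_rpow (inv_pos.2 hp0).ne']
  · have h1 := weak_ge hp e (K⁻¹ • g) (by
      rw [norm_smul, norm_inv, Real.norm_of_nonneg hK]
      exact (inv_mul_le_one₀ h0).2 hg)
    have h2 : ∀ i, ‖(K⁻¹ • g) (e i)‖ ^ p = (K⁻¹) ^ p * ‖g (e i)‖ ^ p := by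
      intro i
      rw [smul_apply, norm_smul, norm_inv, Real.norm_of_nonneg hK,
        Real.mul_rpow (by positivity) (by positivity)]
    simp_rw [h2] at h1
    rw [← Finset.mul_sum, Real.mul_rpow (by positivity)
      (Finset.sum_nonneg fun _ _ => by positivity), ← Real.rpow_mul (by positivity),
      mul_one_div_cancel hp0.ne', Real.rpow_one, inv_mul_le_iff₀ h0] at h1
    exact h1

end weak

/-- `T` is not `p`-summing. -/
lemma TT_not (p : ℝ) (hp : 1 < p) (n : ℕ → ℕ) (hn : ∀ i, 0 < n i) : ¬ IsPSumming p (TT n hn) := by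
  rintro ⟨C, hC, h⟩
  have hp0 : 0 < p := by linarith
  -- weak norm bound
  have key : ∀ N : ℕ, weakNorm p (fun i : Fin N => hh n i) ≤ (Real.sqrt N) ^ (1 / p) := by
    intro N
    refine weak_le _ fun g hg => ?_
    refine Real.rpow_le_rpow (Finset.sum_nonneg fun _ _ => by positivity) ?_ (by positivity)
    set a : Fin N → ℝ := fun i => g (hh n i) with ha
    have ha2 : ∑ i, a i ^ 2 ≤ 1 := by
      set A := ∑ i, a i ^ 2 with hA
      have hA0 : 0 ≤ A := Finset.sum_nonneg fun _ _ => sq_nonneg _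
      have e1 : A = g (∑ i : Fin N, a i • hh n i) := by
        rw [map_sum, hA]
        refine Finset.sum_congr rfl fun i _ => ?_
        rw [map_smul, smul_eq_mul, sq]
      have e2 : ‖∑ i : Fin N, a i • hh n i‖ ≤ Real.sqrt A := by
        rw [ContinuousMap.norm_le _ (Real.sqrt_nonneg _)]
        intro t
        set v : HH := (∑ i : Fin N, a i • hh n i) t with hv
        have ev : v = ∑ i : Fin N, a i • hh n i t := by
          rw [hv]; simp
        have e3 : ‖v‖ ^ 2 = ∑ i : Fin N, a i * inner ℝ (hh n i t) v := by
          rw [← real_inner_self_eq_norm_sq]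
          refine (congrArg (fun w => inner ℝ w v) ev).trans ?_
          simp_rw [sum_inner, real_inner_smul_left]
        have e4 := Finset.sum_mul_sq_le_sq_mul_sq Finset.univ a
          (fun i : Fin N => inner ℝ (hh n i t) v)
        have e5 : ∑ i : Fin N, inner ℝ (hh n i t) v ^ 2 ≤ ‖v‖ ^ 2 := by
          have := bessel n hn (Finset.range N) t v
          rwa [← Fin.sum_univ_eq_sum_range (fun i => inner ℝ (hh n i t) v ^ 2)] at this
        rw [← e3] at e4
        have e6 : (‖v‖ ^ 2) ^ 2 ≤ A * ‖v‖ ^ 2 := e4.trans (mul_le_mul_of_nonneg_left e5 hA0)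
        apply Real.le_sqrt_of_sq_le
        by_contra hlt
        push Not at hlt
        nlinarith
      have e7 : A ≤ Real.sqrt A := by
        calc A = g (∑ i : Fin N, a i • hh n i) := e1
          _ ≤ ‖g (∑ i : Fin N, a i • hh n i)‖ := le_abs_self _
          _ ≤ 1 * ‖∑ i : Fin N, a i • hh n i‖ := g.le_of_opNorm_le hg _
          _ ≤ Real.sqrt A := by rw [one_mul]; exact e2
      have := Real.sq_sqrt hA0
      nlinarith [Real.sqrt_nonneg A]
    have ha1 : ∀ i, |a i| ≤ 1 := by
      intro i
      rw [← sq_le_one_iff_abs_le_one]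
      exact (Finset.single_le_sum (f := fun i => a i ^ 2) (fun _ _ => sq_nonneg _)
        (Finset.mem_univ i)).trans ha2
    have h1 : ∑ i, ‖a i‖ ^ p ≤ ∑ i, |a i| := by
      refine Finset.sum_le_sum fun i _ => ?_
      have := Real.rpow_le_rpow_of_exponent_ge_of_imp (abs_nonneg (a i)) (ha1 i) hp.le
        (fun _ h => absurd h hp0.ne')
      simpa using this
    refine h1.trans ?_
    apply Real.le_sqrt_of_sq_le
    have h2 := sq_sum_le_card_mul_sum_sq (s := Finset.univ) (f := fun i => |a i|)
    simp only [sq_abs, Finset.card_univ, Fintype.card_fin] at h2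
    have : (0:ℝ) ≤ N := by positivity
    nlinarith
  have key2 : ∀ N : ℕ, (N * (1/2) ^ p) ^ (1/p) ≤ C * (Real.sqrt N) ^ (1/p) := by
    intro N
    refine le_trans ?_ ((h N (fun i => hh n i)).trans (mul_le_mul_of_nonneg_left (key N) hC))
    refine Real.rpow_le_rpow (by positivity) ?_ (by positivity)
    calc (N:ℝ) * (1/2) ^ p = ∑ i : Fin N, (1/2 : ℝ) ^ p := by simp
      _ ≤ _ := by
        refine Finset.sum_le_sum fun i _ => Real.rpow_le_rpow (by norm_num) ?_ hp0.le
        have := lp.norm_apply_le_norm (p := 2) (by simp) (TT n hn (hh n i)) i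
        rw [TT_apply, diag_int n hn] at this
        simpa using this
  have key3 : ∀ N : ℕ, (N : ℝ) * (1/2) ^ p ≤ C ^ p * Real.sqrt N := by
    intro N
    have := Real.rpow_le_rpow (by positivity) (key2 N) hp0.le
    rwa [Real.mul_rpow hC (by positivity), ← Real.rpow_mul (by positivity),
      ← Real.rpow_mul (by positivity), one_div_mul_cancel hp0.ne', Real.rpow_one,
      Real.rpow_one] at this
  have hd : (0:ℝ) < (1/2) ^ p := by positivity
  obtain ⟨M, hM⟩ := exists_nat_gt (C ^ p / (1/2) ^ p)
  have h5 := key3 ((M + 1) ^ 2)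
  push_cast at h5
  rw [Real.sqrt_sq (by positivity)] at h5
  rw [div_lt_iff₀ hd] at hM
  have hM1 : (0:ℝ) < M + 1 := by positivity
  have : ((M:ℝ) + 1) * (1/2) ^ p ≤ C ^ p := by
    have : ((M:ℝ) + 1) * (((M:ℝ) + 1) * (1/2) ^ p) ≤ (M + 1) * C ^ p := by linarith
    exact le_of_mul_le_mul_left this hM1
  linarith

lemma exists_n (q : ℝ) (hq : 0 < q) (i : ℕ) :
    ∃ n : ℕ, 0 < n ∧ (Real.sqrt (1 / n)) ^ (1 / q) ≤ (1/2 : ℝ) ^ (i + 1) := by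
  have h1 : Filter.Tendsto (fun n : ℕ => (Real.sqrt (1 / (n:ℝ))) ^ (1 / q)) Filter.atTop
      (nhds 0) := by
    have h := ((Real.continuous_sqrt.tendsto 0).comp
      (tendsto_one_div_atTop_nhds_zero_nat (𝕜 := ℝ))).rpow_const (p := 1 / q)
      (Or.inr (by positivity))
    rw [Real.sqrt_zero, Real.zero_rpow (by positivity)] at h
    exact h
  have h2 := (h1.eventually_le_const (u := (1/2 : ℝ) ^ (i + 1)) (by positivity)).and
    (Filter.eventually_gt_atTop 0)
  obtain ⟨n, hn, hn'⟩ := h2.exists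
  exact ⟨n, hn', hn⟩

lemma memLp_lam {f : UI → ℝ} (hf : Continuous f) (r : ℝ≥0∞) : MemLp f r lam := by
  obtain ⟨C, hC⟩ := isCompact_univ.exists_bound_of_continuousOn hf.continuousOn
  exact MemLp.of_bound hf.aestronglyMeasurable C
    (Filter.Eventually.of_forall fun t => hC t (Set.mem_univ t))

lemma coord_bound (p q : ℝ) (hpq : p.HolderConjugate q) (n : ℕ → ℕ) (hn : ∀ i, 0 < n i) (i : ℕ)
    (hni : (Real.sqrt (1 / n i)) ^ (1 / q) ≤ (1/2 : ℝ) ^ (i + 1)) (f : C(UI, ℝ)) (y : HH)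
    (hy : ‖y‖ = 1) :
    |∫ t, inner ℝ (hh n i t) (f t • y) ∂lam|
      ≤ (1/2 : ℝ) ^ (i + 1) * (∫ t, |f t| ^ p ∂lam) ^ (1 / p) := by
  have hp : 1 < p := hpq.lt
  have hq : 1 < q := hpq.symm.lt
  have hq0 : 0 < q := by linarith
  have hf : Continuous f := f.continuous
  have hu : Continuous fun t => inner ℝ (hh n i t) y :=
    (hh n i).continuous.inner continuous_const
  have hu1 : ∀ t, |inner ℝ (hh n i t) y| ≤ 1 := fun t => (abs_inner_hh_le n hn i t y).trans hy.le
  have hfp : 0 ≤ ∫ t, |f t| ^ p ∂lam := integral_nonneg fun t => by positivity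
  have h1 : |∫ t, inner ℝ (hh n i t) (f t • y) ∂lam|
      ≤ ∫ t, |f t| * |inner ℝ (hh n i t) y| ∂lam := by
    refine (abs_integral_le_integral_abs).trans (le_of_eq ?_)
    congr 1
    ext t
    rw [real_inner_smul_right, abs_mul]
  have h2 := integral_mul_le_Lp_mul_Lq_of_nonneg (μ := lam) hpq
    (f := fun t => |f t|) (g := fun t => |inner ℝ (hh n i t) y|)
    (Filter.Eventually.of_forall fun t => abs_nonneg _)
    (Filter.Eventually.of_forall fun t => abs_nonneg _)
    (memLp_lam hf.abs _) (memLp_lam hu.abs _)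
  have h3 : ∫ t, |inner ℝ (hh n i t) y| ^ q ∂lam ≤ Real.sqrt (1 / n i) := by
    calc ∫ t, |inner ℝ (hh n i t) y| ^ q ∂lam ≤ ∫ t, |inner ℝ (hh n i t) y| ∂lam := by
          refine integral_mono (integrable_lam (hu.abs.rpow_const fun _ => Or.inr hq0.le))
            (integrable_lam hu.abs) ?_
          intro t
          have := Real.rpow_le_rpow_of_exponent_ge_of_imp (abs_nonneg (inner ℝ (hh n i t) y))
            (hu1 t) hq.le (fun _ h => absurd h hq0.ne')
          simpa using this
      _ ≤ Real.sqrt (1 / n i) := by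
          apply Real.le_sqrt_of_sq_le
          refine (sq_int_le hu.abs).trans ?_
          simp_rw [sq_abs]
          have := int_sq n hn i y
          rwa [hy, one_pow] at this
  have h4 : (∫ t, |inner ℝ (hh n i t) y| ^ q ∂lam) ^ (1 / q) ≤ (1/2 : ℝ) ^ (i + 1) :=
    (Real.rpow_le_rpow (integral_nonneg fun t => by positivity) h3 (by positivity)).trans hni
  refine h1.trans (h2.trans ?_)
  rw [mul_comm]
  exact mul_le_mul_of_nonneg_right h4 (Real.rpow_nonneg hfp _)

/-- `y ↦ f ⊗ y` as a bounded operator. -/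
def tens (f : C(UI, ℝ)) : HH →L[ℝ] C(UI, HH) :=
  LinearMap.mkContinuous
    { toFun := fun y => cmSmul f y
      map_add' := by intro y z; ext1 t; exact smul_add _ _ _
      map_smul' := by intro r y; ext1 t; exact smul_comm _ _ _ } ‖f‖ (by
    intro y
    refine (ContinuousMap.norm_le _ (by positivity)).2 fun t => ?_
    change ‖f t • y‖ ≤ _
    rw [norm_smul]
    exact mul_le_mul_of_nonneg_right (f.norm_coe_le_norm t) (norm_nonneg _))

/-- The operator `T#`. -/
def SS (n : ℕ → ℕ) (hn : ∀ i, 0 < n i) (f : C(UI, ℝ)) : HH →L[ℝ] HH := (TT n hn).comp (tens f)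

lemma SS_coord (n : ℕ → ℕ) (hn : ∀ i, 0 < n i) (f : C(UI, ℝ)) (y : HH) (i : ℕ) :
    SS n hn f y i = ∫ t, inner ℝ (hh n i t) (f t • y) ∂lam := rfl

lemma minkowski {p : ℝ} (hp : 1 < p) {m : ℕ} (b : ℕ → Fin m → ℝ) (hb : ∀ i k, 0 ≤ b i k)
    (l : ℕ → ℝ) (h : ∀ i, (∑ k, b i k ^ p) ^ (1 / p) ≤ l i) (s : Finset ℕ) :
    (∑ k, (∑ i ∈ s, b i k) ^ p) ^ (1 / p) ≤ ∑ i ∈ s, l i := by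
  have hp0 : 0 < p := by linarith
  induction s using Finset.induction_on with
  | empty => simp [Real.zero_rpow hp0.ne', Real.zero_rpow (inv_pos.2 hp0).ne']
  | insert a s ha ih =>
    simp_rw [Finset.sum_insert ha]
    refine (Real.Lp_add_le_of_nonneg Finset.univ hp.le (fun k _ => hb a k)
      (fun k _ => Finset.sum_nonneg fun i _ => hb i k)).trans ?_
    exact add_le_add (h a) ih

lemma sum_half (s : Finset ℕ) : ∑ i ∈ s, (1/2 : ℝ) ^ (i + 1) ≤ 1 := by
  have h : HasSum (fun i : ℕ => (1/2 : ℝ) ^ (i + 1)) 1 := by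
    have := hasSum_geometric_two.mul_left (1/2 : ℝ)
    simp_rw [← pow_succ'] at this
    simpa using this
  exact sum_le_hasSum s (fun i _ => by positivity) h

lemma SS_summing (p q : ℝ) (hpq : p.HolderConjugate q) (n : ℕ → ℕ) (hn : ∀ i, 0 < n i)
    (hni : ∀ i, (Real.sqrt (1 / n i)) ^ (1 / q) ≤ (1/2 : ℝ) ^ (i + 1)) (f : C(UI, ℝ)) :
    SummingWithC p p ((∫ t, |f t| ^ p ∂lam) ^ (1 / p)) (SS n hn f) := by
  intro m e
  have hp : 1 < p := hpq.lt
  have hp0 : 0 < p := by linarith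
  set F := (∫ t, |f t| ^ p ∂lam) ^ (1 / p) with hF
  have hF0 : 0 ≤ F := Real.rpow_nonneg (integral_nonneg fun t => by positivity) _
  set W := weakNorm p e with hW
  have hW0 : 0 ≤ W := weak_nonneg e
  have h1 : ∀ i, (∑ k, |SS n hn f (e k) i| ^ p) ^ (1 / p) ≤ (1/2 : ℝ) ^ (i + 1) * F * W := by
    intro i
    let ev : HH →L[ℝ] ℝ := lp.evalCLM ℝ (fun _ : ℕ => ℝ) 2 i
    refine weak_ge' hp e (ev.comp (SS n hn f)) (by positivity) ?_
    refine ContinuousLinearMap.opNorm_le_of_unit_norm (by positivity) fun y hy => ?_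
    exact coord_bound p q hpq n hn i (hni i) f y hy
  have h2 : ∀ s : Finset ℕ, (∑ k, ‖∑ i ∈ s, (lp.single 2 i (SS n hn f (e k) i) : HH)‖ ^ p) ^ (1 / p)
      ≤ F * W := by
    intro s
    calc _ ≤ (∑ k, (∑ i ∈ s, |SS n hn f (e k) i|) ^ p) ^ (1 / p) := by
          refine Real.rpow_le_rpow (Finset.sum_nonneg fun _ _ => by positivity)
            (Finset.sum_le_sum fun k _ => Real.rpow_le_rpow (norm_nonneg _) ?_ hp0.le)
            (by positivity)
          refine (norm_sum_le _ _).trans (Finset.sum_le_sum fun i _ => ?_)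
          rw [lp.norm_single (by simp)]
          rfl
      _ ≤ ∑ i ∈ s, (1/2 : ℝ) ^ (i + 1) * F * W :=
          minkowski hp _ (fun i k => abs_nonneg _) _ h1 s
      _ = (∑ i ∈ s, (1/2 : ℝ) ^ (i + 1)) * (F * W) := by
          rw [Finset.sum_mul]; simp_rw [mul_assoc]
      _ ≤ F * W := mul_le_of_le_one_left (by positivity) (sum_half s)
  have h3 : ∀ k, HasSum (fun i => (lp.single 2 i (SS n hn f (e k) i) : HH)) (SS n hn f (e k)) :=
    fun k => lp.hasSum_single (by simp) _
  refine le_of_tendsto (x := (Filter.atTop : Filter (Finset ℕ))) ?_ (Filter.Eventually.of_forall h2)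
  refine Filter.Tendsto.rpow_const ?_ (Or.inr (by positivity))
  exact tendsto_finsetSum _ fun k _ =>
    (Filter.Tendsto.norm (h3 k)).rpow_const (Or.inr hp0.le)

lemma SS_pNorm (p q : ℝ) (hpq : p.HolderConjugate q) (n : ℕ → ℕ) (hn : ∀ i, 0 < n i)
    (hni : ∀ i, (Real.sqrt (1 / n i)) ^ (1 / q) ≤ (1/2 : ℝ) ^ (i + 1)) (f : C(UI, ℝ)) :
    pNorm p (SS n hn f) ^ p ≤ ∫ t, |f t| ^ p ∂lam := by
  have hp : 1 < p := hpq.lt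
  have hp0 : 0 < p := by linarith
  have hI : 0 ≤ ∫ t, |f t| ^ p ∂lam := integral_nonneg fun t => by positivity
  have h0 : 0 ≤ pNorm p (SS n hn f) := Real.sInf_nonneg fun C hC => hC.1
  have h1 : pNorm p (SS n hn f) ≤ (∫ t, |f t| ^ p ∂lam) ^ (1 / p) :=
    csInf_le ⟨0, fun C hC => hC.1⟩ ⟨Real.rpow_nonneg hI _, SS_summing p q hpq n hn hni f⟩
  have := Real.rpow_le_rpow h0 h1 hp0.le
  rwa [← Real.rpow_mul hI, one_div_mul_cancel hp0.ne', Real.rpow_one] at this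

lemma SS_final (p q : ℝ) (hpq : p.HolderConjugate q) (n : ℕ → ℕ) (hn : ∀ i, 0 < n i)
    (hni : ∀ i, (Real.sqrt (1 / n i)) ^ (1 / q) ≤ (1/2 : ℝ) ^ (i + 1)) (m : ℕ)
    (v : Fin m → C(UI, ℝ)) :
    (∑ i, pNorm p (SS n hn (v i)) ^ p) ^ (1 / p) ≤ 1 * weakNorm p v := by
  have hp : 1 < p := hpq.lt
  have hp0 : 0 < p := by linarith
  rw [one_mul]
  set W := weakNorm p v with hW
  have hW0 : 0 ≤ W := weak_nonneg v
  have h1 : ∑ i, pNorm p (SS n hn (v i)) ^ p ≤ W ^ p := by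
    have hc : ∀ i, Continuous fun t => |v i t| ^ p :=
      fun i => (v i).continuous.abs.rpow_const fun _ => Or.inr hp0.le
    calc _ ≤ ∑ i, ∫ t, |v i t| ^ p ∂lam :=
          Finset.sum_le_sum fun i _ => SS_pNorm p q hpq n hn hni (v i)
      _ = ∫ t, ∑ i, |v i t| ^ p ∂lam := by
          rw [integral_finsetSum _ (fun i _ => integrable_lam (hc i))]
      _ ≤ ∫ t, W ^ p ∂lam := by
          refine integral_mono (integrable_lam (by fun_prop)) (integrable_lam (by fun_prop)) ?_
          intro t
          have h2 := weak_ge hp v (ContinuousMap.evalCLM ℝ t) (by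
            refine ContinuousLinearMap.opNorm_le_bound _ zero_le_one fun f => ?_
            rw [one_mul]
            exact f.norm_coe_le_norm t)
          have h3 := Real.rpow_le_rpow (by positivity) h2 hp0.le
          rw [← Real.rpow_mul (by positivity), one_div_mul_cancel hp0.ne', Real.rpow_one] at h3
          exact h3
      _ = W ^ p := by simp
  have h0 : 0 ≤ ∑ i, pNorm p (SS n hn (v i)) ^ p :=
    Finset.sum_nonneg fun i _ => Real.rpow_nonneg (Real.sInf_nonneg fun C hC => hC.1) _
  have := Real.rpow_le_rpow h0 h1 (by positivity : 0 ≤ 1 / p)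
  rwa [← Real.rpow_mul hW0, mul_one_div_cancel hp0.ne', Real.rpow_one] at this

end Helpers

/-- Theorem 10: for each `1 < p < ∞` there exists a bounded linear operator
`T : C([0,1], ℓ₂) → ℓ₂` that is not p-summing, but such that `T#` maps `C[0,1]` into
`Π_p(ℓ₂, ℓ₂)` and `T# : C[0,1] → Π_p(ℓ₂, ℓ₂)` is p-summing.  Here `T# : C[0,1] → L(ℓ₂, ℓ₂)`
is the map `S` with `(S f) y = T (f ⊗ y)`, `(f ⊗ y)(t) = f(t) y`, and its p-summing property
is expressed via the p-summing norms `π_p(S f)` of its values. -/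
theorem statement11 (p : ℝ) (hp : 1 < p) :
    ∃ T : C(Set.Icc (0 : ℝ) 1, ↥(lp (fun _ : ℕ => ℝ) 2)) →L[ℝ] ↥(lp (fun _ : ℕ => ℝ) 2),
      ¬ IsPSumming p T ∧
      ∃ S : C(Set.Icc (0 : ℝ) 1, ℝ) →
          (↥(lp (fun _ : ℕ => ℝ) 2) →L[ℝ] ↥(lp (fun _ : ℕ => ℝ) 2)),
        (∀ f y, S f y = T (cmSmul f y)) ∧
        (∀ f, IsPSumming p (S f)) ∧
        ∃ C, 0 ≤ C ∧ ∀ (n : ℕ) (v : Fin n → C(Set.Icc (0 : ℝ) 1, ℝ)),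
          (∑ i, pNorm p (S (v i)) ^ p) ^ (1 / p) ≤ C * weakNorm p v := by
  have hpq : p.HolderConjugate (p.conjExponent) := Real.HolderConjugate.conjExponent hp
  choose n hn hni using exists_n p.conjExponent hpq.symm.pos
  refine ⟨TT n hn, TT_not p hp n hn, SS n hn, fun f y => rfl, fun f => ?_, 1, zero_le_one,
    fun m v => SS_final p _ hpq n hn hni m v⟩
  exact ⟨_, Real.rpow_nonneg (MeasureTheory.integral_nonneg fun t => by positivity) _,
    SS_summing p _ hpq n hn hni f⟩
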